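/- Let 0 < a ≤ 1, P > 0 with aP ≥ 1, and C12 ≥ 0. Set Pu = 1/a, Pw = (P − 1/a)/(1 + 1/b), D = Pu + 2, and define the rates R1 = C((2+a)Pw/D), R2 = 2·C(aPw/D) + C12, R3 = C((1+a)Pw/D) + C12, R4 = C((1+a)Pw/D) + C(aPw/D), R5 = (3/2)·C((1+a)Pw/D), and the achievable sum-rate Rsum = min{R1, R2, R3, R4, R5} + log₂(1 + 1/(2a)). Define the upper bounds Rub1 = (1/2)·log₂(1 + b·P) + (1/2)·log₂((1+P)/(1+aP)) and Rub2 = C12 + log₂((P + (aP+1)²)/(aP+1)). Then min{Rub1, Rub2} − Rsum ≤ 2. -/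

import Mathlib

lemma aux1 (a b y : ℝ) (ha : 0 < a) (hb1 : 1 ≤ b) (hb2 : b ≤ 2 + 2 * a) (hy : 0 ≤ y) :
    (a + b * (1 + y)) * (a + (1 + y)) * (1 + b) ≤
      4 * (1 + (1 + y)) * ((1 + b) * (1 + 2 * a) + (1 + a) * y * b) * (1 + 2 * a) := by
  have c0 : 0 ≤ (1 + b) * (8 * (1 + 2 * a) ^ 2 - (a + b) * (a + 1)) := by
    apply mul_nonneg (by linarith)
    nlinarith [mul_nonneg (sub_nonneg.2 hb2) ha.le, sq_nonneg a]
  have c1 : 0 ≤ (1 + b) * (4 * (1 + 2 * a) ^ 2 - (a * b + 2 * b + a)) := by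
    apply mul_nonneg (by linarith)
    nlinarith [mul_nonneg (sub_nonneg.2 hb2) ha.le, sq_nonneg a]
  have c1' : 0 ≤ 8 * (1 + 2 * a) * (1 + a) * b := by positivity
  have c2 : 0 ≤ b * (4 * (1 + a) * (1 + 2 * a) - (1 + b)) := by
    apply mul_nonneg (by linarith)
    nlinarith [sq_nonneg a]
  have h1 := mul_nonneg (add_nonneg c1 c1') hy
  have h2 := mul_nonneg c2 (sq_nonneg y)
  linarith [c0, h1, h2]

lemma aux2 (a b y : ℝ) (ha : 0 < a) (hb1 : 1 ≤ b) (hy : 0 ≤ y) :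
    ((1 + y) + a * ((1 + y) + 1) ^ 2) * (1 + b) ≤
      2 * ((1 + y) + 1) * ((1 + b) * (1 + 2 * a) + a * y * b) := by
  have c0 : 0 ≤ (1 + b) * (3 + 4 * a) := by positivity
  have c1 : 0 ≤ ((1 + b) + 4 * a * b) * y := by positivity
  have c2 : 0 ≤ a * (b - 1) * y ^ 2 :=
    mul_nonneg (mul_nonneg ha.le (by linarith)) (sq_nonneg y)
  linarith [c0, c1, c2]

/-- Theorem 1 of the paper (weak interference regime, universal power allocation):
the achievable sum-rate is within two bits of both upper bounds.
Here `C x = (1/2)·log₂(1+x)` and `b = (1+√a)²`. -/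
theorem stmt_0 (a P C12 : ℝ) (ha0 : 0 < a) (ha1 : a ≤ 1) (hP : 0 < P)
    (haP : 1 ≤ a * P) (hC12 : 0 ≤ C12) :
    let C : ℝ → ℝ := fun x => (1 / 2) * Real.logb 2 (1 + x)
    let b : ℝ := (1 + Real.sqrt a) ^ 2
    let Pu : ℝ := 1 / a
    let Pw : ℝ := (P - 1 / a) / (1 + 1 / b)
    let D : ℝ := Pu + 2
    let R1 : ℝ := C ((2 + a) * Pw / D)
    let R2 : ℝ := 2 * C (a * Pw / D) + C12
    let R3 : ℝ := C ((1 + a) * Pw / D) + C12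
    let R4 : ℝ := C ((1 + a) * Pw / D) + C (a * Pw / D)
    let R5 : ℝ := (3 / 2) * C ((1 + a) * Pw / D)
    let Rsum : ℝ := min R1 (min R2 (min R3 (min R4 R5))) + Real.logb 2 (1 + 1 / (2 * a))
    let Rub1 : ℝ := (1 / 2) * Real.logb 2 (1 + b * P) +
      (1 / 2) * Real.logb 2 ((1 + P) / (1 + a * P))
    let Rub2 : ℝ := C12 + Real.logb 2 ((P + (a * P + 1) ^ 2) / (a * P + 1))
    min Rub1 Rub2 - Rsum ≤ 2 := by
  intro C b Pu Pw D R1 R2 R3 R4 R5 Rsum Rub1 Rub2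
  have hs0 : 0 ≤ Real.sqrt a := Real.sqrt_nonneg a
  have hsq : Real.sqrt a ^ 2 = a := Real.sq_sqrt ha0.le
  have hb1 : 1 ≤ b := by simp only [b]; nlinarith
  have hb2 : b ≤ 2 + 2 * a := by simp only [b]; nlinarith [sq_nonneg (Real.sqrt a - 1)]
  obtain ⟨y, hy⟩ : ∃ y, y = a * P - 1 := ⟨_, rfl⟩
  have hy0 : 0 ≤ y := by linarith
  have hPe : P = (1 + y) / a := by field_simp; linarith
  have hb0 : 0 < b := by linarith
  obtain ⟨t, ht⟩ : ∃ t, t = y * b / ((1 + b) * (1 + 2 * a)) := ⟨_, rfl⟩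
  have ht0 : 0 ≤ t := by rw [ht]; positivity
  have htD : Pw / D = t := by
    simp only [Pw, D, Pu]
    rw [ht, hPe]
    clear_value b
    field_simp
    ring
  have e1 : R1 = C ((2 + a) * t) := by simp only [R1]; rw [mul_div_assoc, htD]
  have e2 : R2 = 2 * C (a * t) + C12 := by simp only [R2]; rw [mul_div_assoc, htD]
  have e3 : R3 = C ((1 + a) * t) + C12 := by simp only [R3]; rw [mul_div_assoc, htD]
  have e4 : R4 = C ((1 + a) * t) + C (a * t) := by
    simp only [R4]; rw [mul_div_assoc, mul_div_assoc, htD]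
  have e5 : R5 = (3 / 2) * C ((1 + a) * t) := by simp only [R5]; rw [mul_div_assoc, htD]
  have hC0 : ∀ x, 0 ≤ x → 0 ≤ C x := fun x hx => by
    have := Real.logb_nonneg (b := 2) (x := 1 + x) (by norm_num) (by linarith)
    simp only [C]; linarith
  have hmono : C ((1 + a) * t) ≤ C ((2 + a) * t) := by
    have := Real.logb_le_logb_of_le (b := 2) (x := 1 + (1 + a) * t) (y := 1 + (2 + a) * t)
      (by norm_num) (by positivity) (by nlinarith)
    simp only [C]; linarith
  have hA := hC0 (a * t) (by positivity)
  have hB := hC0 ((1 + a) * t) (by positivity)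
  have l2 : Real.logb 2 2 = 1 := Real.logb_self_eq_one (by norm_num)
  have l4 : Real.logb 2 4 = 2 := by
    rw [show (4 : ℝ) = 2 ^ 2 by norm_num, Real.logb_pow, l2]; norm_num
  have l16 : Real.logb 2 16 = 4 := by
    rw [show (16 : ℝ) = 2 ^ 4 by norm_num, Real.logb_pow, l2]; norm_num
  have hL0 : 0 < 1 + 1 / (2 * a) := by positivity
  have hu0 : 0 < 1 + (1 + a) * t := by positivity
  have hv0 : 0 < 1 + a * t := by positivity
  have k1 : Rub1 ≤ 2 + C ((1 + a) * t) + Real.logb 2 (1 + 1 / (2 * a)) := by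
    have key : (1 + b * P) * ((1 + P) / (1 + a * P)) ≤
        16 * (1 + (1 + a) * t) * (1 + 1 / (2 * a)) ^ 2 := by
      have := aux1 a b y ha0 hb1 hb2 hy0
      have e : (1 + b * P) * ((1 + P) / (1 + a * P)) =
          ((a + b * (1 + y)) * (a + (1 + y)) * (1 + b)) /
            (a ^ 2 * (1 + (1 + y)) * (1 + b)) := by
        rw [hPe]
        clear_value b
        field_simp
      have e' : 16 * (1 + (1 + a) * t) * (1 + 1 / (2 * a)) ^ 2 =
          (4 * (1 + (1 + y)) * ((1 + b) * (1 + 2 * a) + (1 + a) * y * b) * (1 + 2 * a)) /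
            (a ^ 2 * (1 + (1 + y)) * (1 + b)) := by
        rw [ht]
        clear_value b
        field_simp
        ring
      rw [e, e']
      exact div_le_div_of_nonneg_right this (by positivity)
    have hl := Real.logb_le_logb_of_le (b := 2) (by norm_num) (by positivity) key
    rw [Real.logb_mul (by positivity) (by positivity),
      Real.logb_mul (by positivity) (by positivity),
      Real.logb_mul (by positivity) (by positivity), Real.logb_pow, l16] at hl
    push_cast at hl
    simp only [Rub1, C]
    linarith
  have k2 : Rub2 ≤ 2 + R2 + Real.logb 2 (1 + 1 / (2 * a)) := by
    have key : (P + (a * P + 1) ^ 2) / (a * P + 1) ≤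
        4 * (1 + a * t) * (1 + 1 / (2 * a)) := by
      have := aux2 a b y ha0 hb1 hy0
      have e : (P + (a * P + 1) ^ 2) / (a * P + 1) =
          (((1 + y) + a * ((1 + y) + 1) ^ 2) * (1 + b)) /
            (a * ((1 + y) + 1) * (1 + b)) := by
        rw [hPe]
        clear_value b
        field_simp
      have e' : 4 * (1 + a * t) * (1 + 1 / (2 * a)) =
          (2 * ((1 + y) + 1) * ((1 + b) * (1 + 2 * a) + a * y * b)) /
            (a * ((1 + y) + 1) * (1 + b)) := by
        rw [ht]
        clear_value b
        field_simp
        ring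
      rw [e, e']
      exact div_le_div_of_nonneg_right this (by positivity)
    have hl := Real.logb_le_logb_of_le (b := 2) (by norm_num) (by positivity) key
    rw [Real.logb_mul (by positivity) (by positivity),
      Real.logb_mul (by positivity) (by positivity), l4] at hl
    rw [e2]
    simp only [Rub2, C]
    linarith
  have m1 : min Rub1 Rub2 ≤ Rub1 := min_le_left _ _
  have m2 : min Rub1 Rub2 ≤ Rub2 := min_le_right _ _
  have hm : min Rub1 Rub2 - 2 - Real.logb 2 (1 + 1 / (2 * a)) ≤
      min R1 (min R2 (min R3 (min R4 R5))) := by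
    refine le_min ?_ (le_min ?_ (le_min ?_ (le_min ?_ ?_)))
    · rw [e1]; linarith
    · linarith
    · rw [e3]; linarith
    · rw [e4]; linarith
    · rw [e5]; linarith
  simp only [Rsum]
  linarith
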